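/- Let Y be a proper, connected, locally connected metric space. Then for every y ∈ Y and every D > 0 there exists M > 0 such that any two points of the open ball B(y, D) can be joined by a continuous path whose image is contained in the open ball B(y, M). -/

import Mathlib

theorem Isometry.dist_segment_left_le {Y E : Type*} [MetricSpace Y] [NormedAddCommGroup E]
    [NormedSpace ℝ E] {ι : Y → E} (hι : Isometry ι) (a b : Y) (t : unitInterval) :
    dist (Path.segment (ι a) (ι b) t) (ι a) ≤ dist a b := by
  rw [Path.segment_apply, dist_lineMap_left, Real.norm_of_nonneg t.2.1, hι.dist_eq]
  exact mul_le_of_le_one_left dist_nonneg t.2.2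

/-- Paths obtained by concatenating finitely many segments `[ι a, ι b]`, where `a` and `b` lie in a
common preconnected set with mutual distances at most `ε`. -/
inductive IsFinePath {Y E : Type*} [MetricSpace Y] [NormedAddCommGroup E] [NormedSpace ℝ E]
    (ι : Y → E) (ε : ℝ) : {a b : Y} → Path (ι a) (ι b) → Prop
  | segment {a b : Y} (C : Set Y) (hC : IsPreconnected C) (ha : a ∈ C) (hb : b ∈ C)
      (hd : ∀ x ∈ C, ∀ y ∈ C, dist x y ≤ ε) : IsFinePath ι ε (Path.segment (ι a) (ι b))
  | trans {a b c : Y} {γ : Path (ι a) (ι b)} {γ' : Path (ι b) (ι c)} :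
      IsFinePath ι ε γ → IsFinePath ι ε γ' → IsFinePath ι ε (γ.trans γ')

section

open Set Filter Topology

variable {Y E : Type*} [MetricSpace Y] [NormedAddCommGroup E] [NormedSpace ℝ E] {ι : Y → E}

theorem IsFinePath.exists_dist_le (hι : Isometry ι) {ε : ℝ} {a b : Y} {γ : Path (ι a) (ι b)}
    (h : IsFinePath ι ε γ) (t : unitInterval) : ∃ z, dist (γ t) (ι z) ≤ ε := by
  induction h generalizing t with
  | @segment a b C hC ha hb hd =>
    exact ⟨a, (hι.dist_segment_left_le a b t).trans (hd a ha b hb)⟩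
  | trans _ _ h₁ h₂ =>
    rw [Path.trans_apply]
    split_ifs
    · exact h₁ _
    · exact h₂ _

/-- In a locally connected space, a preconnected set can be traversed by arbitrarily fine paths. -/
theorem IsPreconnected.exists_isFinePath [LocallyConnectedSpace Y] (hι : Isometry ι) {C : Set Y}
    (hC : IsPreconnected C) {ε : ℝ} (hε : 0 < ε) {a b : Y} (ha : a ∈ C) (hb : b ∈ C) :
    ∃ γ : Path (ι a) (ι b), IsFinePath ι ε γ ∧ ∀ t, ∃ z ∈ C, dist (γ t) (ι z) ≤ ε := by
  refine hC.induction₂' (fun a b ↦ ∃ γ : Path (ι a) (ι b),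
    IsFinePath ι ε γ ∧ ∀ t, ∃ z ∈ C, dist (γ t) (ι z) ≤ ε) ?_ ?_ ha hb
  · intro x hx
    obtain ⟨V, hVε, hVo, hxV, hV⟩ := locallyConnectedSpace_iff_subsets_isOpen_isConnected.1
      inferInstance x _ (Metric.ball_mem_nhds x (half_pos hε))
    have hd : ∀ y ∈ V, ∀ z ∈ V, dist y z ≤ ε := fun y hy z hz ↦ by
      have h₁ := hVε hy
      have h₂ := hVε hz
      rw [Metric.mem_ball] at h₁ h₂
      linarith [dist_triangle_right y z x]
    have key : ∀ y ∈ C, ∀ y' ∈ C, y ∈ V → y' ∈ V → ∃ γ : Path (ι y) (ι y'),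
        IsFinePath ι ε γ ∧ ∀ t, ∃ z ∈ C, dist (γ t) (ι z) ≤ ε := by
      intro y hyC y' _ hy hy'
      refine ⟨_, .segment V hV.isPreconnected hy hy' hd, fun t ↦ ⟨y, hyC, ?_⟩⟩
      exact (hι.dist_segment_left_le y y' t).trans (hd y hy y' hy')
    filter_upwards [self_mem_nhdsWithin, mem_nhdsWithin_of_mem_nhds (hVo.mem_nhds hxV)]
      with y hyC hyV
    exact ⟨key x hx y hyC hxV hyV, key y hyC x hx hyV hxV⟩
  · rintro x y z - - - ⟨γ, hγ, h⟩ ⟨γ', hγ', h'⟩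
    refine ⟨γ.trans γ', hγ.trans hγ', fun t ↦ ?_⟩
    rw [Path.trans_apply]
    split_ifs
    · exact h _
    · exact h' _

theorem IsFinePath.exists_refinement [LocallyConnectedSpace Y] (hι : Isometry ι) {ε δ : ℝ}
    (hδ : 0 < δ) {a b : Y} {γ : Path (ι a) (ι b)} (h : IsFinePath ι ε γ) :
    ∃ γ' : Path (ι a) (ι b), IsFinePath ι δ γ' ∧ ∀ t, dist (γ t) (γ' t) ≤ 2 * ε + δ := by
  induction h with
  | @segment a b C hC ha hb hd =>
    obtain ⟨γ', hγ', hC'⟩ := hC.exists_isFinePath hι hδ ha hb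
    refine ⟨γ', hγ', fun t ↦ ?_⟩
    obtain ⟨z, hz, hzt⟩ := hC' t
    have h₁ : dist (Path.segment (ι a) (ι b) t) (ι a) ≤ ε :=
      (hι.dist_segment_left_le a b t).trans (hd a ha b hb)
    have h₂ : dist (ι a) (ι z) ≤ ε := (hι.dist_eq a z).trans_le (hd a ha z hz)
    rw [dist_comm] at hzt
    linarith [dist_triangle4 (Path.segment (ι a) (ι b) t) (ι a) (ι z) (γ' t)]
  | trans _ _ h₁ h₂ =>
    obtain ⟨γ₁, hγ₁, h₁⟩ := h₁
    obtain ⟨γ₂, hγ₂, h₂⟩ := h₂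
    refine ⟨γ₁.trans γ₂, hγ₁.trans hγ₂, fun t ↦ ?_⟩
    rw [Path.trans_apply, Path.trans_apply]
    split_ifs
    · exact h₁ _
    · exact h₂ _

/-- In a complete locally connected space, a fine path can be approximated by a genuine path. -/
theorem IsFinePath.exists_path [CompleteSpace Y] [LocallyConnectedSpace Y] [CompleteSpace E]
    (hι : Isometry ι) {ε : ℝ} (hε : 0 < ε) {a b : Y} {γ : Path (ι a) (ι b)}
    (h : IsFinePath ι ε γ) :
    ∃ p : Path a b, ∀ t, dist (γ t) (ι (p t)) ≤ 6 * ε := by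
  have hpos : ∀ n : ℕ, 0 < ε * (1 / 2) ^ n := fun n ↦ by positivity
  choose! f hf hdist using fun (n : ℕ) (γ : Path (ι a) (ι b))
    (h : IsFinePath ι (ε * (1 / 2) ^ n) γ) ↦ h.exists_refinement hι (hpos (n + 1))
  let u : ℕ → Path (ι a) (ι b) := fun n ↦ Nat.rec γ f n
  have hu : ∀ n, IsFinePath ι (ε * (1 / 2) ^ n) (u n) := fun n ↦ by
    induction n with
    | zero => simpa [u] using h
    | succ n ih => exact hf n (u n) ih
  let v : ℕ → C(unitInterval, E) := fun n ↦ (u n).toContinuousMap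
  have hv : ∀ n, dist (v n) (v (n + 1)) ≤ 3 * ε * (1 / 2) ^ n := fun n ↦ by
    have := hpos n
    rw [ContinuousMap.dist_le (by positivity)]
    intro t
    refine (hdist n (u n) (hu n) t).trans ?_
    rw [pow_succ]
    linarith
  obtain ⟨F, hF⟩ := cauchySeq_tendsto_of_complete
    (cauchySeq_of_le_geometric (1 / 2) (3 * ε) (by norm_num) hv)
  have hF₀ : dist (v 0) F ≤ 6 * ε :=
    (dist_le_of_le_geometric_of_tendsto₀ _ _ (by norm_num) hv hF).trans_eq (by ring)
  have hFt : ∀ t, Tendsto (fun n ↦ u n t) atTop (𝓝 (F t)) := fun t ↦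
    ((continuous_eval_const t).tendsto F).comp hF
  have hrange : ∀ t, ∃ y, ι y = F t := fun t ↦ by
    choose z hz using fun n ↦ (hu n).exists_dist_le hι t
    have h₀ : Tendsto (fun n : ℕ ↦ ε * (1 / 2 : ℝ) ^ n) atTop (𝓝 0) := by
      simpa using (tendsto_pow_atTop_nhds_zero_of_lt_one (r := (1 / 2 : ℝ))
        (by norm_num) (by norm_num)).const_mul ε
    have h₁ : Tendsto (fun n ↦ ι (z n)) atTop (𝓝 (F t)) :=
      (tendsto_iff_of_dist (squeeze_zero (fun _ ↦ dist_nonneg) hz h₀)).1 (hFt t)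
    exact hι.isClosedEmbedding.isClosed_range.mem_of_tendsto h₁
      (Eventually.of_forall fun n ↦ mem_range_self _)
  choose p hp using hrange
  have hF_eq : ∀ t x, (∀ n, u n t = x) → F t = x := fun t x hx ↦
    tendsto_nhds_unique (hFt t) (by simp [hx])
  refine ⟨⟨⟨p, ?_⟩, ?_, ?_⟩, fun t ↦ ?_⟩
  · rw [hι.isEmbedding.continuous_iff]
    exact F.continuous.congr fun t ↦ (hp t).symm
  · exact hι.injective ((hp 0).trans (hF_eq 0 _ fun n ↦ (u n).source))
  · exact hι.injective ((hp 1).trans (hF_eq 1 _ fun n ↦ (u n).target))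
  · change dist (γ t) (ι (p t)) ≤ _
    rw [hp]
    exact (ContinuousMap.dist_apply_le_dist t).trans hF₀

/-- A complete, separable, locally connected metric space is locally path connected. -/
theorem LocallyPathConnectedSpace.of_complete_locallyConnected (Y : Type*) [MetricSpace Y]
    [CompleteSpace Y] [TopologicalSpace.SeparableSpace Y] [LocallyConnectedSpace Y] :
    LocallyPathConnectedSpace Y := by
  refine ⟨fun x ↦ hasBasis_self.2 fun U hU ↦ ?_⟩
  obtain ⟨r, hr, hrU⟩ := Metric.mem_nhds_iff.1 hU
  refine ⟨pathComponentIn (Metric.ball x r) x, ?_,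
    isPathConnected_pathComponentIn (Metric.mem_ball_self hr),
    pathComponentIn_subset.trans hrU⟩
  have hι := kuratowskiEmbedding.isometry Y
  obtain ⟨V, hVr, hVo, hxV, hV⟩ := locallyConnectedSpace_iff_subsets_isOpen_isConnected.1
    inferInstance x _ (Metric.ball_mem_nhds x (ε := r / 16) (by positivity))
  refine mem_of_superset (hVo.mem_nhds hxV) fun z hz ↦ ?_
  have hd : ∀ y ∈ V, ∀ z ∈ V, dist y z ≤ r / 8 := fun y hy z hz ↦ by
    have h₁ := hVr hy
    have h₂ := hVr hz
    rw [Metric.mem_ball] at h₁ h₂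
    linarith [dist_triangle_right y z x]
  obtain ⟨p, hp⟩ := (IsFinePath.segment (ι := kuratowskiEmbedding Y) V hV.isPreconnected hxV hz
    hd).exists_path hι (by positivity)
  refine ⟨p, fun t ↦ ?_⟩
  have h₁ := hp t
  have h₂ : dist (Path.segment (kuratowskiEmbedding Y x) (kuratowskiEmbedding Y z) t)
      (kuratowskiEmbedding Y x) ≤ r / 8 :=
      (hι.dist_segment_left_le x z t).trans (hd x hxV z hz)
  rw [Metric.mem_ball, ← hι.dist_eq]
  rw [dist_comm] at h₁
  linarith [dist_triangle (kuratowskiEmbedding Y (p t))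
    (Path.segment (kuratowskiEmbedding Y x) (kuratowskiEmbedding Y z) t) (kuratowskiEmbedding Y x)]

/-- In a path connected, locally path connected metric space, the points of a compact set can be
joined to a given base point inside a common ball. -/
theorem IsCompact.exists_joinedIn_ball {Y : Type*} [MetricSpace Y] [PathConnectedSpace Y]
    [LocallyPathConnectedSpace Y] {K : Set Y} (hK : IsCompact K) (y : Y) :
    ∃ M : ℝ, 0 < M ∧ ∀ a ∈ K, JoinedIn (Metric.ball y M) y a := by
  refine hK.induction_on ⟨1, one_pos, by simp⟩ ?_ ?_ ?_
  · rintro s t hst ⟨M, hM, h⟩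
    exact ⟨M, hM, fun a ha ↦ h a (hst ha)⟩
  · rintro s t ⟨M, hM, h⟩ ⟨M', -, h'⟩
    refine ⟨max M M', lt_max_of_lt_left hM, fun a ha ↦ ha.elim (fun ha ↦ ?_) fun ha ↦ ?_⟩
    · exact (h a ha).mono (Metric.ball_subset_ball (le_max_left _ _))
    · exact (h' a ha).mono (Metric.ball_subset_ball (le_max_right _ _))
  · intro x _
    refine ⟨pathComponentIn (Metric.ball x 1) x, mem_nhdsWithin_of_mem_nhds
      (pathComponentIn_mem_nhds (Metric.ball_mem_nhds x one_pos)), ?_⟩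
    let γ := (PathConnectedSpace.joined y x).somePath
    obtain ⟨M, hM, hγ⟩ := (isCompact_range γ.continuous).isBounded.subset_ball_lt 0 y
    refine ⟨M + dist x y + 1, by positivity, fun a ha ↦ ?_⟩
    have h₁ : JoinedIn (Metric.ball y M) y x := ⟨γ, fun t ↦ hγ (mem_range_self t)⟩
    have h₂ : JoinedIn (Metric.ball x 1) x a := ha
    refine (h₁.mono (Metric.ball_subset_ball ?_)).trans (h₂.mono (Metric.ball_subset_ball' ?_))
    · linarith [dist_nonneg (x := x) (y := y)]
    · linarith

end

/-- Lemma 7.2: in a proper, connected, locally connected metric space, for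
every `y` and `D > 0` there is `M > 0` such that any two points of `B(y, D)`
can be joined by a path inside `B(y, M)`. -/
theorem stmt11 {Y : Type*} [MetricSpace Y] [ProperSpace Y] [ConnectedSpace Y]
    [LocallyConnectedSpace Y] (y : Y) (D : ℝ) (hD : 0 < D) :
    ∃ M : ℝ, 0 < M ∧ ∀ a b : Y, a ∈ Metric.ball y D → b ∈ Metric.ball y D →
      ∃ γ : Path a b, Set.range γ ⊆ Metric.ball y M := by
  have := LocallyPathConnectedSpace.of_complete_locallyConnected Y
  have : PathConnectedSpace Y := .of_locallyPathConnectedSpace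
  obtain ⟨M, hM, h⟩ := (isCompact_closedBall y D).exists_joinedIn_ball y
  refine ⟨M, hM, fun a b ha hb ↦ ?_⟩
  obtain ⟨γ, hγ⟩ := (h a (Metric.ball_subset_closedBall ha)).symm.trans
    (h b (Metric.ball_subset_closedBall hb))
  exact ⟨γ, Set.range_subset_iff.2 hγ⟩
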